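/- Let n ≥ 3. There exist no twice continuously differentiable functions Ψ: [0,∞) → ℝ and W_vol: (0,∞) → ℝ with Ψ'(0) > 0 such that the volumetric-isochorically decoupled energy W: GL⁺(n) → ℝ defined by W(F) = Ψ(‖dev_n log V‖²) + W_vol(det F), where V = √(FFᵀ), is rank-one convex on GL⁺(n). -/

import Mathlib

open Matrix Real

attribute [local instance] Matrix.frobeniusNormedAddCommGroup Matrix.frobeniusNormedSpace

noncomputable section

/-- The space of real `n × n` matrices. -/
abbrev Mat (n : ℕ) := Matrix (Fin n) (Fin n) ℝ

/-- `GL⁺(n)`: real `n × n` matrices with positive determinant. -/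
def GLp (n : ℕ) : Set (Mat n) := {F | 0 < F.det}

/-- Frobenius inner product `⟨X, Y⟩ = tr (X Yᵀ)`. -/
def inn {n : ℕ} (X Y : Mat n) : ℝ := (X * Yᵀ).trace

/-- Squared Frobenius norm `‖X‖² = tr (Xᵀ X)`. -/
def nsq {n : ℕ} (X : Mat n) : ℝ := (Xᵀ * X).trace

/-- The primary matrix function associated to `f : ℝ → ℝ`: applies `f` to the eigenvalues
in a spectral decomposition of a Hermitian (i.e. real symmetric) matrix, junk value `0`
otherwise. -/
def matFun {n : ℕ} (f : ℝ → ℝ) (A : Mat n) : Mat n :=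
  if hA : A.IsHermitian then
    (hA.eigenvectorUnitary : Mat n) * Matrix.diagonal (f ∘ hA.eigenvalues) *
      (star (hA.eigenvectorUnitary : Mat n))
  else 0

/-- Principal square root of a symmetric positive semidefinite matrix. -/
def matSqrt {n : ℕ} (A : Mat n) : Mat n := matFun Real.sqrt A

/-- Principal matrix logarithm of a symmetric positive definite matrix. -/
def matLog {n : ℕ} (A : Mat n) : Mat n := matFun Real.log A

/-- `log U` where `U = √(FᵀF)` is the right stretch tensor of `F`. -/
def logU {n : ℕ} (F : Mat n) : Mat n := matLog (matSqrt (Fᵀ * F))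

/-- `log V` where `V = √(FFᵀ)` is the left stretch tensor of `F`. -/
def logV {n : ℕ} (F : Mat n) : Mat n := matLog (matSqrt (F * Fᵀ))

/-- Deviatoric (trace-free) part `dev_n X = X - (tr X / n) 𝟙`. -/
def dev {n : ℕ} (X : Mat n) : Mat n := X - (X.trace / n) • (1 : Mat n)

/-- Rank-one convexity of `W : GL⁺(n) → ℝ`: along every rank-one line segment contained in
`GL⁺(n)`, the function is convex. -/
def RankOneConvex {n : ℕ} (W : Mat n → ℝ) : Prop :=
  ∀ F ∈ GLp n, ∀ ξ η : Fin n → ℝ, ∀ I : Set ℝ, Convex ℝ I →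
    (∀ t ∈ I, 0 < (F + t • vecMulVec ξ η).det) →
    ConvexOn ℝ I (fun t => W (F + t • vecMulVec ξ η))

end

theorem matFun_isHermitian {n : ℕ} (f : ℝ → ℝ) (A : Mat n) : (matFun f A).IsHermitian := by
  unfold matFun
  split_ifs with hA
  · have h := isHermitian_mul_mul_conjTranspose (hA.eigenvectorUnitary : Mat n)
      (isHermitian_diagonal (f ∘ hA.eigenvalues))
    simpa [star_eq_conjTranspose] using h
  · exact isHermitian_zero

theorem roots_charpoly_matFun {n : ℕ} (f : ℝ → ℝ) {A : Mat n} (hA : A.IsHermitian) :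
    (matFun f A).charpoly.roots = A.charpoly.roots.map f := by
  have h : (matFun f A).charpoly =
      ∏ i, (Polynomial.X - Polynomial.C (f (hA.eigenvalues i))) := by
    rw [matFun, dif_pos hA, charpoly_mul_comm, ← mul_assoc]
    simp [charpoly_diagonal]
  rw [h, hA.roots_charpoly_eq_eigenvalues, Polynomial.roots_prod _ _
    (Finset.prod_ne_zero_iff.mpr fun i _ => Polynomial.X_sub_C_ne_zero _)]
  simp only [Polynomial.roots_X_sub_C, Multiset.bind_singleton, Multiset.map_map]
  rfl

theorem trace_eq_sum_charpoly_roots {n : ℕ} {A : Mat n} (hA : A.IsHermitian) :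
    A.trace = A.charpoly.roots.sum := by
  rw [hA.trace_eq_sum_eigenvalues, hA.roots_charpoly_eq_eigenvalues]
  rfl

theorem nsq_matFun {n : ℕ} (f : ℝ → ℝ) {A : Mat n} (hA : A.IsHermitian) :
    nsq (matFun f A) = (A.charpoly.roots.map fun x => f x ^ 2).sum := by
  have hT : (matFun f A)ᵀ = matFun f A := by
    simpa [IsHermitian, conjTranspose_eq_transpose_of_trivial] using matFun_isHermitian f A
  have hsq : matFun f A * matFun f A = matFun (fun x => f x ^ 2) A := by
    have hU : star (hA.eigenvectorUnitary : Mat n) * (hA.eigenvectorUnitary : Mat n) = 1 := by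
      simp
    simp only [matFun, dif_pos hA]
    calc _ = (hA.eigenvectorUnitary : Mat n) * diagonal (f ∘ hA.eigenvalues) *
          (star (hA.eigenvectorUnitary : Mat n) * (hA.eigenvectorUnitary : Mat n)) *
          diagonal (f ∘ hA.eigenvalues) * star (hA.eigenvectorUnitary : Mat n) := by
            simp only [mul_assoc]
      _ = _ := by
        rw [hU, mul_one, mul_assoc (hA.eigenvectorUnitary : Mat n), diagonal_mul_diagonal]
        congr 3
        ext i
        simp [sq]
  rw [nsq, hT, hsq, trace_eq_sum_charpoly_roots (matFun_isHermitian _ _),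
    roots_charpoly_matFun _ hA]

theorem isHermitian_mul_transpose {n : ℕ} (F : Mat n) : (F * Fᵀ).IsHermitian := by
  simpa [conjTranspose_eq_transpose_of_trivial] using isHermitian_mul_conjTranspose_self F

theorem eigenvalues_mul_transpose_pos {n : ℕ} {F : Mat n} (hF : F.det = 1) (i : Fin n) :
    0 < (isHermitian_mul_transpose F).eigenvalues i := by
  have hs : (F * Fᵀ).PosSemidef := by
    simpa [conjTranspose_eq_transpose_of_trivial] using posSemidef_self_mul_conjTranspose F
  refine lt_of_le_of_ne (hs.eigenvalues_nonneg i) fun h => ?_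
  have hd := (isHermitian_mul_transpose F).det_eq_prod_eigenvalues
  rw [Finset.prod_eq_zero (Finset.mem_univ i) (by simpa using h.symm)] at hd
  simp [hF] at hd

/-- The quadratic Hencky strain `‖log V‖²`, read off from the spectrum of `F Fᵀ`. -/
noncomputable def hencky {n : ℕ} (F : Mat n) : ℝ :=
  ((F * Fᵀ).charpoly.roots.map fun μ => Real.log (√μ) ^ 2).sum

theorem nsq_dev_logV {n : ℕ} {F : Mat n} (hF : F.det = 1) :
    nsq (dev (logV F)) = hencky F := by
  have hG := isHermitian_mul_transpose F
  have hpos := eigenvalues_mul_transpose_pos hF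
  have hS := matFun_isHermitian Real.sqrt (F * Fᵀ)
  have htr : (logV F).trace = 0 := by
    have hdet : ∏ i, hG.eigenvalues i = 1 := by
      have := hG.det_eq_prod_eigenvalues
      simpa [hF] using this.symm
    have hlog : ∑ i, Real.log (hG.eigenvalues i) = 0 := by
      rw [← Real.log_prod fun i _ => (hpos i).ne', hdet, Real.log_one]
    rw [logV, matLog, trace_eq_sum_charpoly_roots (matFun_isHermitian _ _), matSqrt,
      roots_charpoly_matFun _ hS, roots_charpoly_matFun _ hG, hG.roots_charpoly_eq_eigenvalues]
    have : ∀ i, Real.log (√(hG.eigenvalues i)) = Real.log (hG.eigenvalues i) / 2 :=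
      fun i => Real.log_sqrt (hpos i).le
    simp only [Multiset.map_map, Function.comp_def, RCLike.ofReal_real_eq_id, id, this]
    change ∑ i, Real.log (hG.eigenvalues i) / 2 = 0
    rw [← Finset.sum_div, hlog, zero_div]
  rw [dev, htr, zero_div, zero_smul, sub_zero, logV, matLog, matSqrt,
    nsq_matFun _ hS, roots_charpoly_matFun _ hG, Multiset.map_map]
  rfl

/-- The matrix `M ⊕ 𝟙` of size `3 + m`. -/
def pad (m : ℕ) (M : Mat 3) : Mat (3 + m) :=
  reindex finSumFinEquiv finSumFinEquiv (fromBlocks M 0 0 (1 : Mat m))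

/-- Extension of a vector of `ℝ³` by zeros. -/
def padVec (m : ℕ) (u : Fin 3 → ℝ) : Fin (3 + m) → ℝ :=
  Sum.elim u 0 ∘ finSumFinEquiv.symm

theorem pad_add_smul_vecMulVec (m : ℕ) (M : Mat 3) (t : ℝ) (ξ η : Fin 3 → ℝ) :
    pad m M + t • vecMulVec (padVec m ξ) (padVec m η) = pad m (M + t • vecMulVec ξ η) := by
  ext i j
  obtain ⟨i, rfl⟩ := finSumFinEquiv.surjective i
  obtain ⟨j, rfl⟩ := finSumFinEquiv.surjective j
  rcases i with i | i <;> rcases j with j | j <;>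
    simp [pad, padVec, vecMulVec_apply, -finSumFinEquiv_apply_left, -finSumFinEquiv_apply_right]

theorem det_pad (m : ℕ) (M : Mat 3) : (pad m M).det = M.det := by
  simp [pad]

theorem hencky_pad (m : ℕ) (M : Mat 3) : hencky (pad m M) = hencky M := by
  have h : pad m M * (pad m M)ᵀ =
      reindex finSumFinEquiv finSumFinEquiv (fromBlocks (M * Mᵀ) 0 0 (1 : Mat m)) := by
    simp [pad, fromBlocks_transpose, fromBlocks_multiply, submatrix_mul_equiv]
  have hX : (Polynomial.X - 1 : Polynomial ℝ) = Polynomial.X - Polynomial.C 1 := by simp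
  rw [hencky, h, charpoly_reindex, charpoly_fromBlocks_zero₁₂, charpoly_one, hX,
    Polynomial.roots_mul (mul_ne_zero (charpoly_monic _).ne_zero
      (pow_ne_zero _ (Polynomial.X_sub_C_ne_zero _))), Polynomial.roots_pow,
    Polynomial.roots_X_sub_C]
  simp [hencky, Multiset.map_nsmul, Multiset.sum_nsmul]

theorem hencky_eq_sum_eigenvalues {n : ℕ} {F : Mat n} (hF : F.det = 1) :
    hencky F = ∑ i, (Real.log ((isHermitian_mul_transpose F).eigenvalues i) / 2) ^ 2 := by
  have : ∀ i, Real.log (√((isHermitian_mul_transpose F).eigenvalues i)) =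
      Real.log ((isHermitian_mul_transpose F).eigenvalues i) / 2 :=
    fun i => Real.log_sqrt (eigenvalues_mul_transpose_pos hF i).le
  rw [hencky, (isHermitian_mul_transpose F).roots_charpoly_eq_eigenvalues]
  simp only [Multiset.map_map, Function.comp_def, RCLike.ofReal_real_eq_id, id, this]
  rfl

/-- Along a line of matrices of determinant one, rank-one convexity of the energy is convexity
of `Ψ ∘ hencky`, in every dimension at least three. -/
theorem RankOneConvex.convexOn_hencky {m : ℕ} {Ψ Wvol : ℝ → ℝ}
    (hW : RankOneConvex (fun F : Mat (3 + m) => Ψ (nsq (dev (logV F))) + Wvol F.det))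
    (M : Mat 3) (ξ η : Fin 3 → ℝ) (hdet : ∀ t : ℝ, (M + t • vecMulVec ξ η).det = 1) :
    ConvexOn ℝ Set.univ (fun t : ℝ => Ψ (hencky (M + t • vecMulVec ξ η))) := by
  have hd : ∀ t : ℝ,
      (pad m M + t • vecMulVec (padVec m ξ) (padVec m η)).det = 1 := fun t => by
    rw [pad_add_smul_vecMulVec, det_pad, hdet]
  have hM : pad m M ∈ GLp (3 + m) := by
    have := hd 0
    rw [zero_smul, add_zero] at this
    simp [GLp, this]
  have h := hW (pad m M) hM (padVec m ξ) (padVec m η) Set.univ convex_univ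
    fun t _ => by rw [hd]; exact one_pos
  refine (h.add_const (-Wvol 1)).congr fun t _ => ?_
  simp only [Pi.add_apply]
  rw [nsq_dev_logV (hd t), hd, pad_add_smul_vecMulVec, hencky_pad]
  ring

theorem hencky_shear (s : ℝ) :
    hencky ((1 : Mat 3) + (Real.exp s - Real.exp (-s)) • vecMulVec ![1, 0, 0] ![0, 1, 0]) =
      2 * s ^ 2 := by
  set w := Real.exp s with hw
  set v := Real.exp (-s) with hv
  have hwv : w * v = 1 := by rw [hw, hv, ← Real.exp_add]; simp
  set F : Mat 3 := 1 + (w - v) • vecMulVec ![1, 0, 0] ![0, 1, 0] with hF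
  have hch : (F * Fᵀ).charpoly = (Polynomial.X - Polynomial.C 1) *
      (Polynomial.X - Polynomial.C (w ^ 2)) * (Polynomial.X - Polynomial.C (v ^ 2)) := by
    refine Polynomial.funext fun x => ?_
    rw [eval_charpoly]
    simp [hF, det_fin_three, Matrix.mul_apply, Fin.sum_univ_three, one_apply]
    have h2 : w ^ 2 * v ^ 2 = 1 := by rw [← mul_pow, hwv, one_pow]
    linear_combination (x - 1) * (2 * x * hwv - h2)
  have hlw : Real.log (√(w ^ 2)) = s := by
    rw [Real.sqrt_sq (Real.exp_pos _).le, Real.log_exp]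
  have hlv : Real.log (√(v ^ 2)) = -s := by
    rw [Real.sqrt_sq (Real.exp_pos _).le, Real.log_exp]
  rw [hencky, hch, Polynomial.roots_mul (mul_ne_zero (mul_ne_zero
      (Polynomial.X_sub_C_ne_zero _) (Polynomial.X_sub_C_ne_zero _))
      (Polynomial.X_sub_C_ne_zero _)), Polynomial.roots_mul (mul_ne_zero
      (Polynomial.X_sub_C_ne_zero _) (Polynomial.X_sub_C_ne_zero _))]
  simp only [Polynomial.roots_X_sub_C, Multiset.map_add, Multiset.map_singleton,
    Multiset.sum_add, Multiset.sum_singleton, hlw, hlv]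
  simp
  ring

theorem strictMonoOn_of_convexOn_sinh {Ψ : ℝ → ℝ} (hd : 0 < derivWithin Ψ (Set.Ici 0) 0)
    {h : ℝ → ℝ} (hc : ConvexOn ℝ Set.univ h)
    (hh : ∀ s : ℝ, h (Real.exp s - Real.exp (-s)) = Ψ (2 * s ^ 2)) :
    StrictMonoOn Ψ (Set.Ici 0) := by
  have hmono : ∀ s₁ s₂ : ℝ, s₁ < s₂ →
      Real.exp s₁ - Real.exp (-s₁) < Real.exp s₂ - Real.exp (-s₂) := fun s₁ s₂ hs =>
    sub_lt_sub (Real.exp_lt_exp.mpr hs) (Real.exp_lt_exp.mpr (neg_lt_neg hs))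
  have key : ∀ a b : ℝ, 0 < a → a < b → h 0 < h a → h a < h b := fun a b ha hab h0 => by
    have hs := hc.slope_mono_adjacent (Set.mem_univ 0) (Set.mem_univ b) ha hab
    have : 0 < (h a - h 0) / (a - 0) := div_pos (by linarith) (by linarith)
    have h2 := (div_pos_iff_of_pos_right (by linarith : (0 : ℝ) < b - a)).mp (this.trans_le hs)
    linarith
  have hh0 : h 0 = Ψ 0 := by simpa using hh 0
  have hda : HasDerivWithinAt Ψ (derivWithin Ψ (Set.Ici 0) 0) (Set.Ici 0) 0 :=
    (differentiableWithinAt_of_derivWithin_ne_zero hd.ne').hasDerivWithinAt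
  have hev : ∀ᶠ x in nhdsWithin (0 : ℝ) (Set.Ioi 0), Ψ 0 < Ψ x := by
    have ht := hasDerivWithinAt_iff_tendsto_slope.mp hda
    rw [Set.Ici_sdiff_left] at ht
    filter_upwards [ht.eventually (lt_mem_nhds hd), self_mem_nhdsWithin] with x hx hx0
    rw [slope_def_field] at hx
    have := (div_pos_iff_of_pos_right (by simpa using hx0)).mp hx
    linarith
  have hpos : ∀ s : ℝ, 0 < s → h 0 < h (Real.exp s - Real.exp (-s)) := fun s hs => by
    have hlt : ∀ᶠ x in nhdsWithin (0 : ℝ) (Set.Ioi 0), x < 2 * s ^ 2 :=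
      nhdsWithin_le_nhds (gt_mem_nhds (by positivity))
    obtain ⟨x, ⟨hx, hxs⟩, hx0⟩ := ((hev.and hlt).and self_mem_nhdsWithin).exists
    have hx0 : 0 < x := hx0
    have hr : 0 < √(x / 2) := Real.sqrt_pos.mpr (by linarith)
    have hr2 : 2 * √(x / 2) ^ 2 = x := by rw [Real.sq_sqrt (by linarith)]; ring
    have hrs : √(x / 2) < s := lt_of_pow_lt_pow_left₀ 2 hs.le (by linarith)
    have h1 : h 0 < h (Real.exp √(x / 2) - Real.exp (-√(x / 2))) := by
      rw [hh, hr2, hh0]; exact hx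
    exact h1.trans (key _ _ (by simpa using hmono 0 _ hr) (hmono _ _ hrs) h1)
  intro k₁ hk₁ k₂ hk₂ hk
  have hk₁ : 0 ≤ k₁ := hk₁
  have e : ∀ k : ℝ, 0 ≤ k → Ψ k = h (Real.exp √(k / 2) - Real.exp (-√(k / 2))) := fun k hk => by
    rw [hh, Real.sq_sqrt (by linarith)]
    congr 1
    ring
  have hs : √(k₁ / 2) < √(k₂ / 2) := Real.sqrt_lt_sqrt (by linarith) (by linarith)
  rcases hk₁.eq_or_lt with rfl | hp
  · rw [e k₂ hk.le, ← hh0]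
    exact hpos _ ((Real.sqrt_nonneg _).trans_lt hs)
  · rw [e _ hk₁, e _ (hk₁.trans hk.le)]
    have hp' : 0 < √(k₁ / 2) := Real.sqrt_pos.mpr (by linarith)
    exact key _ _ (by simpa using hmono 0 _ hp') (hmono _ _ hs) (hpos _ hp')

/-- The elementary symmetric functions of the eigenvalues of `F Fᵀ`. -/
theorem eigenvalues_symmetric {F : Mat 3} (hF : F.det = 1) :
    let l := (isHermitian_mul_transpose F).eigenvalues
    l 0 + l 1 + l 2 = (F * Fᵀ).trace ∧ l 0 * l 1 * l 2 = 1 ∧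
      (1 + l 0) * (1 + l 1) * (1 + l 2) = (1 + F * Fᵀ).det := by
  intro l
  have hG := isHermitian_mul_transpose F
  refine ⟨?_, ?_, ?_⟩
  · rw [hG.trace_eq_sum_eigenvalues, Fin.sum_univ_three]; rfl
  · have := hG.det_eq_prod_eigenvalues
    rw [Fin.prod_univ_three] at this
    simpa [hF] using this.symm
  · have h := congrArg (Polynomial.eval (-1)) hG.charpoly_eq
    rw [eval_charpoly, Polynomial.eval_prod, Fin.prod_univ_three] at h
    have e : scalar (Fin 3) (-1 : ℝ) - F * Fᵀ = -(1 + F * Fᵀ) := by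
      rw [map_neg, map_one, neg_add, sub_eq_add_neg]
    rw [e, det_neg] at h
    simp only [Fintype.card_fin, Polynomial.eval_sub, Polynomial.eval_X, Polynomial.eval_C,
      RCLike.ofReal_real_eq_id, id] at h
    change (1 + hG.eigenvalues 0) * (1 + hG.eigenvalues 1) * (1 + hG.eigenvalues 2) = _
    linear_combination h

theorem hencky_le {F : Mat 3} (hF : F.det = 1) {P Q : ℝ}
    (hP : (F * Fᵀ).trace ≤ P) (hQ : (1 + F * Fᵀ).det - (F * Fᵀ).trace - 2 ≤ Q) :
    hencky F ≤ 3 / 4 * Real.log P * Real.log Q := by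
  obtain ⟨h1, h2, h3⟩ := eigenvalues_symmetric hF
  rw [hencky_eq_sum_eigenvalues hF, Fin.sum_univ_three]
  have p := eigenvalues_mul_transpose_pos hF
  set l := (isHermitian_mul_transpose F).eigenvalues
  have p0 := p 0
  have p1 := p 1
  have p2 := p 2
  have hq : l 0 * l 1 + l 0 * l 2 + l 1 * l 2 ≤ Q := by linarith
  have b : ∀ x y : ℝ, 0 < x → 0 < y → x ≤ P → y ≤ Q → x * y = 1 →
      Real.log x ^ 2 ≤ (Real.log P - Real.log Q) * Real.log x + Real.log P * Real.log Q := by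
    intro x y hx hy hxP hyQ hxy
    have h5 := Real.log_le_log hx hxP
    have h6 := Real.log_le_log hy hyQ
    have h7 : Real.log x + Real.log y = 0 := by
      rw [← Real.log_mul hx.ne' hy.ne', hxy, Real.log_one]
    have : 0 ≤ (Real.log P - Real.log x) * (Real.log Q + Real.log x) :=
      mul_nonneg (by linarith) (by linarith)
    linarith
  have p01 := mul_pos p0 p1
  have p02 := mul_pos p0 p2
  have p12 := mul_pos p1 p2
  have b0 := b (l 0) (l 1 * l 2) p0 p12 (by linarith) (by linarith) (by linarith)
  have b1 := b (l 1) (l 0 * l 2) p1 p02 (by linarith) (by linarith) (by linarith)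
  have b2 := b (l 2) (l 0 * l 1) p2 p01 (by linarith) (by linarith) (by linarith)
  have hs : Real.log (l 0) + Real.log (l 1) + Real.log (l 2) = 0 := by
    rw [← Real.log_mul p0.ne' p1.ne', ← Real.log_mul p01.ne' p2.ne', h2, Real.log_one]
  have hs' := congrArg ((Real.log P - Real.log Q) * ·) hs
  simp only [mul_zero] at hs'
  linarith

theorem le_hencky {F : Mat 3} (hF : F.det = 1) {R S : ℝ} (hR : 1 < R) (hS : 1 < S)
    (hP : 3 * R ≤ (F * Fᵀ).trace) (hQ : 3 * S ≤ (1 + F * Fᵀ).det - (F * Fᵀ).trace - 2) :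
    (Real.log R ^ 2 + Real.log S ^ 2) / 4 ≤ hencky F := by
  obtain ⟨h1, h2, h3⟩ := eigenvalues_symmetric hF
  rw [hencky_eq_sum_eigenvalues hF]
  have p := eigenvalues_mul_transpose_pos hF
  set l := (isHermitian_mul_transpose F).eigenvalues
  have hi : ∃ i, R ≤ l i := by
    by_contra! h
    linarith [h 0, h 1, h 2]
  have hj : ∃ j, S ≤ (l j)⁻¹ := by
    by_contra! h
    have e0 : (l 0)⁻¹ = l 1 * l 2 := inv_eq_of_mul_eq_one_right (by linarith)
    have e1 : (l 1)⁻¹ = l 0 * l 2 := inv_eq_of_mul_eq_one_right (by linarith)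
    have e2 : (l 2)⁻¹ = l 0 * l 1 := inv_eq_of_mul_eq_one_right (by linarith)
    have g0 := h 0
    have g1 := h 1
    have g2 := h 2
    rw [e0] at g0
    rw [e1] at g1
    rw [e2] at g2
    linarith
  obtain ⟨i, hi⟩ := hi
  obtain ⟨j, hj⟩ := hj
  have hij : i ≠ j := by
    rintro rfl
    have := (one_lt_inv₀ (p i)).mp (hS.trans_le hj)
    linarith
  have hli := Real.log_le_log (by linarith) hi
  have hlj := Real.log_le_log (by linarith) hj
  rw [Real.log_inv] at hlj
  have hR0 := Real.log_pos hR
  have hS0 := Real.log_pos hS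
  calc (Real.log R ^ 2 + Real.log S ^ 2) / 4
      ≤ (Real.log (l i) / 2) ^ 2 + (Real.log (l j) / 2) ^ 2 := by nlinarith
    _ = ∑ k ∈ {i, j}, (Real.log (l k) / 2) ^ 2 := by rw [Finset.sum_pair hij]
    _ ≤ ∑ k, (Real.log (l k) / 2) ^ 2 :=
      Finset.sum_le_sum_of_subset_of_nonneg (Finset.subset_univ _) fun _ _ _ => sq_nonneg _

/-- The rank-one line `t ↦ lineMat t` of determinant one along which the strain measure has a
large value at the midpoint of `[0, 1]`. -/
noncomputable def lineMat (t : ℝ) : Mat 3 :=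
  diagonal ![2 ^ 16, 2 ^ 16, (2 ^ 32)⁻¹] +
    t • vecMulVec ![1, 0, (2 ^ 32)⁻¹] ![-2 ^ 16, 2 ^ 32, 1]

theorem lineMat_eq (t : ℝ) :
    lineMat t = !![2 ^ 16 - 2 ^ 16 * t, 2 ^ 32 * t, t; 0, 2 ^ 16, 0;
      -(t / 2 ^ 16), t, (1 + t) / 2 ^ 32] := by
  ext i j
  fin_cases i <;> fin_cases j <;> simp [lineMat] <;> ring

theorem det_lineMat (t : ℝ) : (lineMat t).det = 1 := by
  rw [lineMat_eq, det_fin_three]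
  simp
  ring

theorem trace_lineMat (t : ℝ) :
    (lineMat t * (lineMat t)ᵀ).trace = (2 ^ 16 - 2 ^ 16 * t) ^ 2 + (2 ^ 32 * t) ^ 2 + t ^ 2 +
      (2 ^ 16) ^ 2 + (t / 2 ^ 16) ^ 2 + t ^ 2 + ((1 + t) / 2 ^ 32) ^ 2 := by
  simp only [trace_fin_three, Matrix.mul_apply, Fin.sum_univ_three, transpose_apply]
  simp [lineMat_eq]
  ring

theorem det_one_add_lineMat (t : ℝ) :
    (1 + lineMat t * (lineMat t)ᵀ).det = (lineMat t * (lineMat t)ᵀ).trace + 2 +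
      (((1 + t) / 2 ^ 16) ^ 2 + t ^ 2 + (2 ^ 16 * t) ^ 2 + (1 / 2 ^ 16) ^ 2 + t ^ 2 +
        (2 ^ 16 * t) ^ 2 + (2 ^ 32 * (1 - t)) ^ 2) := by
  rw [trace_lineMat, det_fin_three]
  simp only [Matrix.add_apply, Matrix.mul_apply, Fin.sum_univ_three, transpose_apply]
  simp [lineMat_eq]
  ring

theorem hencky_lineMat_zero_le :
    hencky (lineMat 0) ≤ 3 / 4 * Real.log (2 ^ 34) * Real.log (2 ^ 65) := by
  refine hencky_le (det_lineMat 0) ?_ ?_ <;> rw [trace_lineMat] <;>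
    norm_num [det_one_add_lineMat, trace_lineMat]

theorem hencky_lineMat_one_le :
    hencky (lineMat 1) ≤ 3 / 4 * Real.log (2 ^ 65) * Real.log (2 ^ 34) := by
  refine hencky_le (det_lineMat 1) ?_ ?_ <;> rw [trace_lineMat] <;>
    norm_num [det_one_add_lineMat, trace_lineMat]

theorem le_hencky_lineMat_half :
    (Real.log (2 ^ 60) ^ 2 + Real.log (2 ^ 60) ^ 2) / 4 ≤ hencky (lineMat (1 / 2)) := by
  refine le_hencky (det_lineMat _) (by norm_num) (by norm_num) ?_ ?_ <;> rw [trace_lineMat] <;>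
    norm_num [det_one_add_lineMat, trace_lineMat]

theorem hencky_nonneg {n : ℕ} (F : Mat n) : 0 ≤ hencky F := by
  refine Multiset.sum_nonneg fun x hx => ?_
  obtain ⟨μ, -, rfl⟩ := Multiset.mem_map.mp hx
  exact sq_nonneg _

/-- **Theorem 6.1.** For `n ≥ 3`, there are no twice continuously differentiable functions
`Ψ : [0,∞) → ℝ` and `W_vol : (0,∞) → ℝ` with `Ψ'(0) > 0` such that the
volumetric-isochorically decoupled energy `W(F) = Ψ(‖dev_n log V‖²) + W_vol(det F)`
(with `V = √(FFᵀ)`) is rank-one convex on `GL⁺(n)`. -/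
theorem no_rank_one_convex_vol_iso_split
    (n : ℕ) (hn : 3 ≤ n) :
    ¬ ∃ (Ψ Wvol : ℝ → ℝ),
      ContDiffOn ℝ 2 Ψ (Set.Ici 0) ∧
      ContDiffOn ℝ 2 Wvol (Set.Ioi 0) ∧
      0 < derivWithin Ψ (Set.Ici 0) 0 ∧
      RankOneConvex (fun F : Mat n => Ψ (nsq (dev (logV F))) + Wvol F.det) := by
  obtain ⟨m, rfl⟩ := Nat.exists_eq_add_of_le hn
  rintro ⟨Ψ, Wvol, -, -, hd, hW⟩
  have hshear := hW.convexOn_hencky 1 ![1, 0, 0] ![0, 1, 0] fun t => by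
    simp [det_fin_three, one_apply]
  have hmono := strictMonoOn_of_convexOn_sinh hd hshear fun s => congrArg Ψ (hencky_shear s)
  have hline : ConvexOn ℝ Set.univ fun t => Ψ (hencky (lineMat t)) :=
    hW.convexOn_hencky _ _ _ det_lineMat
  have hlog : 0 < Real.log 2 := Real.log_pos one_lt_two
  have h0 := hencky_lineMat_zero_le
  have h1 := hencky_lineMat_one_le
  have h2 := le_hencky_lineMat_half
  simp only [Real.log_pow, Nat.cast_ofNat] at h0 h1 h2
  have hsq := pow_pos hlog 2
  have g0 := hmono (hencky_nonneg _) (hencky_nonneg _)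
    (show hencky (lineMat 0) < hencky (lineMat (1 / 2)) by nlinarith)
  have g1 := hmono (hencky_nonneg _) (hencky_nonneg _)
    (show hencky (lineMat 1) < hencky (lineMat (1 / 2)) by nlinarith)
  have hc := hline.2 (Set.mem_univ 0) (Set.mem_univ 1) one_half_pos.le one_half_pos.le
    (add_halves (1 : ℝ))
  norm_num at hc g0 g1
  linarith
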